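/- Let 𝓗 = 𝓗₁ ⊕ 𝓗₂ be a nontrivial orthogonal decomposition of 𝓗, let 𝓜₁ be a nonempty subset of 𝔖(𝓗₁) bounded from below, and let 𝓜 := { A₁ ⊕ 0 : A₁ ∈ 𝓜₁ } ⊆ 𝔖(𝓗), where A₁ ⊕ 0 is the operator with block representation having A₁ in the 𝓗₁-corner and zeros elsewhere. (i) If M₁ is a maximal lower bound of 𝓜₁, then M₁ ⊕ 0 is a maximal lower bound of 𝓜. (ii) If, additionally, 𝓜₁ is a finite set, then every maximal lower bound M of 𝓜 has the form M₁ ⊕ 0 for some maximal lower bound M₁ of 𝓜₁. -/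

import Mathlib

noncomputable section

variable {H : Type*} [NormedAddCommGroup H] [InnerProductSpace ℂ H] [CompleteSpace H]

/-- The (real) value `(Su, u)` of the quadratic form of a bounded operator `S`
(for self-adjoint `S` the inner product `⟪Su, u⟫` is real, and equals this value). -/
def qform (S : H →L[ℂ] H) (u : H) : ℝ := (inner ℂ (S u) u : ℂ).re

/-- Löwner's partial order on bounded self-adjoint operators:
`S ≤ T` iff `(Su,u) ≤ (Tu,u)` for all `u ∈ H`. -/
def LoewnerLE (S T : H →L[ℂ] H) : Prop := ∀ u : H, qform S u ≤ qform T u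

/-- The set `𝔏(𝓜)` of lower bounds of `M` within the bounded self-adjoint operators. -/
def lowerBoundsSA (M : Set (H →L[ℂ] H)) : Set (H →L[ℂ] H) :=
  {L | IsSelfAdjoint L ∧ ∀ A ∈ M, LoewnerLE L A}

/-- `G` is the greatest element of the set `L` with respect to Löwner's order. -/
def IsGreatestSA (L : Set (H →L[ℂ] H)) (G : H →L[ℂ] H) : Prop :=
  G ∈ L ∧ ∀ X ∈ L, LoewnerLE X G

/-- `M` is a maximal element of the set `L` with respect to Löwner's order. -/
def IsMaximalSA (L : Set (H →L[ℂ] H)) (M : H →L[ℂ] H) : Prop :=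
  M ∈ L ∧ ∀ X ∈ L, LoewnerLE M X → X = M

variable {H₁ H₂ : Type*} [NormedAddCommGroup H₁] [InnerProductSpace ℂ H₁] [CompleteSpace H₁]
  [NormedAddCommGroup H₂] [InnerProductSpace ℂ H₂] [CompleteSpace H₂]

/-- The block operator `A₁ ⊕ 0` on the orthogonal direct sum `H₁ ⊕ H₂`, having `A₁` in the
`H₁`-corner and zeros elsewhere. -/
def blockOp (A₁ : H₁ →L[ℂ] H₁) : WithLp 2 (H₁ × H₂) →L[ℂ] WithLp 2 (H₁ × H₂) :=
  (((WithLp.prodContinuousLinearEquiv 2 ℂ H₁ H₂).symm :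
      H₁ × H₂ →L[ℂ] WithLp 2 (H₁ × H₂))).comp
    ((A₁.prodMap 0).comp
      ((WithLp.prodContinuousLinearEquiv 2 ℂ H₁ H₂ :
        WithLp 2 (H₁ × H₂) →L[ℂ] H₁ × H₂)))

theorem aux_inner_sa {T : H →L[ℂ] H} (hT : IsSelfAdjoint T) (x y : H) :
    inner ℂ (T x) y = inner ℂ x (T y) :=
  (ContinuousLinearMap.isSelfAdjoint_iff_isSymmetric.1 hT) x y

theorem aux_sqrt (T : H →L[ℂ] H) (hT : IsSelfAdjoint T) (hpos : ∀ u, 0 ≤ qform T u) :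
    ∃ R : H →L[ℂ] H, IsSelfAdjoint R ∧ ∀ u, T u = R (R u) := by
  have h0 : 0 ≤ T := by
    rw [ContinuousLinearMap.nonneg_iff_isPositive, ContinuousLinearMap.isPositive_def']
    exact ⟨hT, hpos⟩
  refine ⟨CFC.sqrt T, (CFC.sqrt_nonneg T).isSelfAdjoint, fun u => ?_⟩
  conv_lhs => rw [← CFC.sqrt_mul_sqrt_self T h0]
  rfl

theorem aux_qform_sq {R : H →L[ℂ] H} (hR : IsSelfAdjoint R) (T : H →L[ℂ] H)
    (h : ∀ u, T u = R (R u)) (u : H) : qform T u = ‖R u‖ ^ 2 := by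
  unfold qform
  rw [h, aux_inner_sa hR]
  exact inner_self_eq_norm_sq (𝕜 := ℂ) (R u)

theorem aux_zero (T : H →L[ℂ] H) (hT : IsSelfAdjoint T) (hpos : ∀ u, 0 ≤ qform T u)
    (u : H) (hu : qform T u = 0) : T u = 0 := by
  obtain ⟨R, hR, h⟩ := aux_sqrt T hT hpos
  rw [aux_qform_sq hR T h] at hu
  have : R u = 0 := by simpa using hu
  rw [h, this, map_zero]

theorem aux_qform_sub (S T : H →L[ℂ] H) (u : H) :
    qform (S - T) u = qform S u - qform T u := by
  simp [qform, inner_sub_left]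

/-- Krein's shorted operator. -/
theorem aux_short (T : H →L[ℂ] H) (hT : IsSelfAdjoint T) (hpos : ∀ u, 0 ≤ qform T u)
    (V : Submodule ℂ H) :
    ∃ S : H →L[ℂ] H, IsSelfAdjoint S ∧ (∀ v ∈ V, S v = 0) ∧ (∀ u, qform S u ≤ qform T u) ∧
      ∀ u c, (∀ v ∈ V, c ≤ qform T (u + v)) → c ≤ qform S u := by
  obtain ⟨R, hR, h⟩ := aux_sqrt T hT hpos
  let W : Submodule ℂ H := (V.map (R : H →ₗ[ℂ] H)).topologicalClosure
  haveI : CompleteSpace W :=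
    (Submodule.isClosed_topologicalClosure _).completeSpace_coe
  let Q : H →L[ℂ] H := Wᗮ.starProjection
  have hQ : IsSelfAdjoint Q := isSelfAdjoint_starProjection _
  have hQQ : ∀ v, Q (Q v) = Q v := fun v =>
    Submodule.starProjection_eq_self_iff.2 (Submodule.starProjection_apply_mem _ _)
  let S : H →L[ℂ] H := R * Q * R
  have hS : ∀ u, S u = R (Q (R u)) := fun u => rfl
  have hqS : ∀ u, qform S u = ‖Q (R u)‖ ^ 2 := by
    intro u
    unfold qform
    rw [hS, aux_inner_sa hR, ← hQQ, aux_inner_sa hQ, hQQ]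
    exact inner_self_eq_norm_sq (𝕜 := ℂ) (Q (R u))
  have hQv : ∀ v, Q v = v - W.starProjection v := by
    intro v
    change Wᗮ.starProjection v = _
    rw [Submodule.starProjection_orthogonal_val]
  refine ⟨S, ?_, ?_, ?_, ?_⟩
  · change star (R * Q * R) = R * Q * R
    rw [star_mul, star_mul, hR.star_eq, hQ.star_eq, mul_assoc]
  · intro v hv
    have hm : R v ∈ W := Submodule.le_topologicalClosure _ ⟨v, hv, rfl⟩
    rw [hS, hQv, Submodule.starProjection_eq_self_iff.2 hm, sub_self, map_zero]
  · intro u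
    rw [hqS, aux_qform_sq hR T h]
    have : ‖Q (R u)‖ ≤ ‖R u‖ := Submodule.norm_starProjection_apply_le _ _
    gcongr
  · intro u c hc
    have hcl : (W : Set H) ⊆ {w | c ≤ ‖R u + w‖ ^ 2} := by
      rw [Submodule.topologicalClosure_coe]
      refine closure_minimal ?_ (isClosed_le (by fun_prop) (by fun_prop))
      rintro _ ⟨v, hv, rfl⟩
      have := hc v hv
      rw [aux_qform_sq hR T h, map_add] at this
      exact this
    have hm : -(W.starProjection (R u)) ∈ W :=
      W.neg_mem (Submodule.starProjection_apply_mem _ _)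
    have := hcl hm
    rw [hqS, hQv, sub_eq_add_neg]
    exact this

theorem aux_block_apply (A : H₁ →L[ℂ] H₁) (u : WithLp 2 (H₁ × H₂)) :
    blockOp A u = WithLp.toLp 2 (A u.fst, 0) := rfl

theorem aux_block_qform (A : H₁ →L[ℂ] H₁) (u : WithLp 2 (H₁ × H₂)) :
    qform (blockOp A) u = qform A u.fst := by
  unfold qform
  rw [aux_block_apply, WithLp.prod_inner_apply]
  simp

theorem aux_block_sa (A : H₁ →L[ℂ] H₁) (hA : IsSelfAdjoint A) :
    IsSelfAdjoint (blockOp A : WithLp 2 (H₁ × H₂) →L[ℂ] WithLp 2 (H₁ × H₂)) := by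
  rw [ContinuousLinearMap.isSelfAdjoint_iff_isSymmetric]
  intro x y
  change inner ℂ (blockOp A x) y = inner ℂ x (blockOp A y)
  rw [aux_block_apply, aux_block_apply, WithLp.prod_inner_apply, WithLp.prod_inner_apply]
  simp [aux_inner_sa hA]

theorem aux_block_le (A B : H₁ →L[ℂ] H₁) :
    LoewnerLE (blockOp A : WithLp 2 (H₁ × H₂) →L[ℂ] WithLp 2 (H₁ × H₂)) (blockOp B) ↔
      LoewnerLE A B := by
  constructor
  · intro h x
    have := h (WithLp.toLp 2 (x, 0))
    rwa [aux_block_qform, aux_block_qform] at this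
  · intro h u
    rw [aux_block_qform, aux_block_qform]
    exact h _

theorem aux_block_inj {A B : H₁ →L[ℂ] H₁}
    (h : (blockOp A : WithLp 2 (H₁ × H₂) →L[ℂ] WithLp 2 (H₁ × H₂)) = blockOp B) : A = B := by
  ext x
  have := congrArg (fun T : WithLp 2 (H₁ × H₂) →L[ℂ] WithLp 2 (H₁ × H₂) =>
    (T (WithLp.toLp 2 (x, 0))).fst) h
  exact this

theorem aux_block_lb (M₁ : Set (H₁ →L[ℂ] H₁)) (L : H₁ →L[ℂ] H₁) (hL : L ∈ lowerBoundsSA M₁) :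
    blockOp (H₂ := H₂) L ∈ lowerBoundsSA ((blockOp (H₂ := H₂)) '' M₁) := by
  refine ⟨aux_block_sa _ hL.1, ?_⟩
  rintro _ ⟨A, hA, rfl⟩
  exact (aux_block_le _ _).2 (hL.2 A hA)

/-- A self-adjoint operator vanishing on the second summand is a block operator. -/
theorem aux_block_of (N : WithLp 2 (H₁ × H₂) →L[ℂ] WithLp 2 (H₁ × H₂)) (hN : IsSelfAdjoint N)
    (h0 : ∀ u : WithLp 2 (H₁ × H₂), u.fst = 0 → N u = 0) :
    ∃ N₁ : H₁ →L[ℂ] H₁, IsSelfAdjoint N₁ ∧ N = blockOp N₁ := by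
  let e := WithLp.prodContinuousLinearEquiv 2 ℂ H₁ H₂
  let N₁ : H₁ →L[ℂ] H₁ := (ContinuousLinearMap.fst ℂ H₁ H₂).comp
    ((e : WithLp 2 (H₁ × H₂) →L[ℂ] H₁ × H₂).comp (N.comp
      ((e.symm : H₁ × H₂ →L[ℂ] WithLp 2 (H₁ × H₂)).comp (ContinuousLinearMap.inl ℂ H₁ H₂))))
  have hN₁ : ∀ x, N₁ x = (N (WithLp.toLp 2 (x, 0))).fst := fun x => rfl
  have hsnd : ∀ u, (N u).snd = 0 := by
    intro u
    let w : WithLp 2 (H₁ × H₂) := WithLp.toLp 2 (0, (N u).snd)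
    have h1 : inner ℂ (N u) w = 0 := by
      rw [aux_inner_sa hN, h0 w rfl, inner_zero_right]
    rw [WithLp.prod_inner_apply] at h1
    have h2 : inner ℂ (N u).snd (N u).snd = (0 : ℂ) := by
      simpa [w] using h1
    exact inner_self_eq_zero.1 h2
  refine ⟨N₁, ?_, ?_⟩
  · rw [ContinuousLinearMap.isSelfAdjoint_iff_isSymmetric]
    intro x y
    change inner ℂ (N₁ x) y = inner ℂ x (N₁ y)
    have := aux_inner_sa hN (WithLp.toLp 2 (x, 0)) (WithLp.toLp 2 (y, 0))
    rw [WithLp.prod_inner_apply, WithLp.prod_inner_apply] at this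
    simpa [hN₁] using this
  · ext1 u
    have hu : N u = N (WithLp.toLp 2 (u.fst, 0)) := by
      rw [← sub_eq_zero, ← map_sub]
      apply h0
      simp
    have hs := hsnd u
    rw [aux_block_apply, hN₁, ← hu, ← hs]
    rfl

/-- Corollary 4.3a: for a nontrivial orthogonal decomposition `H = H₁ ⊕ H₂` and
`𝓜 = {A₁ ⊕ 0 : A₁ ∈ 𝓜₁}`: (i) if `M₁` is a maximal lower bound of `𝓜₁` then `M₁ ⊕ 0` is a
maximal lower bound of `𝓜`; (ii) if moreover `𝓜₁` is finite, every maximal lower bound of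
`𝓜` has the form `M₁ ⊕ 0` for some maximal lower bound `M₁` of `𝓜₁`. -/
theorem stmt9 [Nontrivial H₁] [Nontrivial H₂]
    (M₁ : Set (H₁ →L[ℂ] H₁)) (hne : M₁.Nonempty)
    (hsa : ∀ A ∈ M₁, IsSelfAdjoint A)
    (hbdd : (lowerBoundsSA M₁).Nonempty) :
    (∀ N₁, IsMaximalSA (lowerBoundsSA M₁) N₁ →
      IsMaximalSA (lowerBoundsSA ((blockOp (H₂ := H₂)) '' M₁)) (blockOp N₁)) ∧
    (M₁.Finite → ∀ N, IsMaximalSA (lowerBoundsSA ((blockOp (H₂ := H₂)) '' M₁)) N →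
      ∃ N₁, IsMaximalSA (lowerBoundsSA M₁) N₁ ∧ N = blockOp N₁) := by
  have fst0 : ∀ (A : H₁ →L[ℂ] H₁) (u : WithLp 2 (H₁ × H₂)), u.fst = 0 →
      qform (blockOp A) u = 0 := by
    intro A u hu
    rw [aux_block_qform, hu]
    simp [qform]
  obtain ⟨A₀, hA₀⟩ := hne
  constructor
  · intro N₁ hN₁
    refine ⟨aux_block_lb _ _ hN₁.1, ?_⟩
    intro X hX hle
    have hvan : ∀ u : WithLp 2 (H₁ × H₂), u.fst = 0 → X u = 0 := by
      intro u hu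
      have hz : (X - blockOp (H₂ := H₂) N₁) u = 0 := by
        apply aux_zero _ (hX.1.sub (aux_block_sa _ hN₁.1.1))
        · intro v
          rw [aux_qform_sub]
          exact sub_nonneg.2 (hle v)
        · have h1 := hle u
          have h2 := hX.2 _ ⟨A₀, hA₀, rfl⟩ u
          rw [fst0 _ _ hu] at h1 h2
          rw [aux_qform_sub, fst0 _ _ hu]
          linarith
      rw [sub_apply, aux_block_apply, hu, map_zero] at hz
      have hz' : X u - 0 = 0 := hz
      rwa [sub_zero] at hz'
    obtain ⟨X₁, hX₁, rfl⟩ := aux_block_of X hX.1 hvan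
    congr 1
    exact hN₁.2 X₁ ⟨hX₁, fun A hA => (aux_block_le _ _).1 (hX.2 _ ⟨A, hA, rfl⟩)⟩
      ((aux_block_le _ _).1 hle)
  · intro _ N hN
    let T : WithLp 2 (H₁ × H₂) →L[ℂ] WithLp 2 (H₁ × H₂) := blockOp A₀ - N
    have hBA := aux_block_sa (H₂ := H₂) A₀ (hsa A₀ hA₀)
    let V : Submodule ℂ (WithLp 2 (H₁ × H₂)) :=
      { carrier := {u | u.fst = 0}
        add_mem' := fun {a b} ha hb => by
          change a.fst + b.fst = 0
          rw [show a.fst = 0 from ha, show b.fst = 0 from hb, add_zero]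
        zero_mem' := rfl
        smul_mem' := fun c a ha => by
          change c • a.fst = 0
          rw [show a.fst = 0 from ha, smul_zero] }
    obtain ⟨S, hS, hSV, hST, hSc⟩ := aux_short T (hBA.sub hN.1.1)
      (fun u => by
        rw [aux_qform_sub]
        exact sub_nonneg.2 (hN.1.2 _ ⟨A₀, hA₀, rfl⟩ u)) V
    have hXN : blockOp A₀ - S = N := by
      apply hN.2
      · refine ⟨hBA.sub hS, ?_⟩
        rintro _ ⟨A, hA, rfl⟩ u
        rw [aux_qform_sub]
        have := hSc u (qform (blockOp A₀) u - qform (blockOp A) u) (by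
          intro v hv
          have hf : (u + v).fst = u.fst := by
            change u.fst + v.fst = u.fst
            rw [show v.fst = 0 from hv, add_zero]
          have h1 := hN.1.2 _ ⟨A, hA, rfl⟩ (u + v)
          rw [aux_block_qform, hf] at h1
          rw [aux_qform_sub, aux_block_qform, aux_block_qform, aux_block_qform, hf]
          linarith)
        linarith
      · intro u
        have := hST u
        rw [aux_qform_sub] at this ⊢
        linarith
    obtain ⟨N₁, hN₁, rfl⟩ := aux_block_of N hN.1.1 (by
      intro u hu
      rw [← hXN, sub_apply, hSV u hu, aux_block_apply, hu, map_zero]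
      simp)
    refine ⟨N₁, ⟨⟨hN₁, fun A hA => (aux_block_le _ _).1 (hN.1.2 _ ⟨A, hA, rfl⟩)⟩, ?_⟩, rfl⟩
    intro Y hY hle
    exact aux_block_inj (hN.2 _ (aux_block_lb _ _ hY) ((aux_block_le _ _).2 hle))
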